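/- Let n ≥ 1, ε > 0, and set δ := √(45ε/n); assume δ ≤ 0.7. Let v, v′ ∈ {−1,1}ⁿ, let k > 0, and let r_1, …, r_n ∈ ℝ³ with ‖r_i‖ ≤ 1 for all i. If ∑_{i=1}^n ⟨r_i, n̂^{δ v′_i}⟩ ≥ n − kε, then ∑_{i=1}^n ⟨r_i, n̂^{δ v_i}⟩ ≥ n − (k + 30√(2k) + 90)·ε. -/

import Mathlib

open Real InnerProductGeometry
open scoped RealInnerProductSpace

/-- The unit vector `n̂^θ = (sin(π/4+θ), 0, cos(π/4+θ)) ∈ ℝ³`. -/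
noncomputable def nhat (θ : ℝ) : EuclideanSpace ℝ (Fin 3) :=
  (WithLp.equiv 2 (Fin 3 → ℝ)).symm ![Real.sin (π/4 + θ), 0, Real.cos (π/4 + θ)]

/-- The vector `ŵ = (1/√2, 0, -1/√2) ∈ ℝ³`. -/
noncomputable def what : EuclideanSpace ℝ (Fin 3) :=
  (WithLp.equiv 2 (Fin 3 → ℝ)).symm ![1 / Real.sqrt 2, 0, -(1 / Real.sqrt 2)]

lemma inner_nhat (α β : ℝ) : ⟪nhat α, nhat β⟫ = Real.cos (α - β) := by
  have h : α - β = (π / 4 + α) - (π / 4 + β) := by ring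
  rw [h, Real.cos_sub]
  simp [nhat, PiLp.inner_apply, Fin.sum_univ_three]
  ring

lemma norm_nhat (α : ℝ) : ‖nhat α‖ = 1 := by
  have h := real_inner_self_eq_norm_sq (nhat α)
  rw [inner_nhat, sub_self, Real.cos_zero] at h
  nlinarith [norm_nonneg (nhat α)]

lemma norm_nhat_sub_le (α β : ℝ) : ‖nhat α - nhat β‖ ≤ |α - β| := by
  apply abs_le_of_sq_le_sq' _ (abs_nonneg _) |>.2
  rw [norm_sub_sq_real, inner_nhat, norm_nhat, norm_nhat, sq_abs]
  linarith [Real.one_sub_sq_div_two_le_cos (x := α - β)]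

/-- Replacing the unit vector `a` by a unit vector `b` at distance at most `D`. -/
lemma inner_sub_le_inner_of_norm_sub_le {E : Type*} [NormedAddCommGroup E]
    [InnerProductSpace ℝ E] {r a b : E} {D : ℝ} (ha : ‖a‖ = 1) (hb : ‖b‖ = 1)
    (hab : ‖b - a‖ ≤ D) :
    ⟪r, a⟫ - D * ‖r - a‖ - D ^ 2 / 2 ≤ ⟪r, b⟫ := by
  have h1 := neg_le_of_abs_le (abs_real_inner_le_norm (r - a) (b - a))
  have h2 : ‖r - a‖ * ‖b - a‖ ≤ ‖r - a‖ * D := by gcongr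
  have h3 : ‖b - a‖ ^ 2 ≤ D ^ 2 := by gcongr
  have h4 := norm_sub_sq_real b a
  rw [inner_sub_left, inner_sub_right, inner_sub_right, real_inner_self_eq_norm_sq,
    real_inner_comm b a] at h1
  rw [ha, hb] at h4
  rw [ha] at h1
  linarith

/-- With `δ := √(45ε/n) ≤ 0.7`: if Bloch vectors `rᵢ` (with `‖rᵢ‖ ≤ 1`) satisfy
`∑ᵢ ⟨rᵢ, n̂^{δ v'ᵢ}⟩ ≥ n - kε`, then `∑ᵢ ⟨rᵢ, n̂^{δ vᵢ}⟩ ≥ n - (k + 30√(2k) + 90)ε`, i.e.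
any state in the `kε`-optimum of `H_{v'}^δ` lies in the `(k + 30√(2k) + 90)ε`-optimum of
`H_v^δ`. -/
theorem vicinity_transfer (n : ℕ) (hn : 1 ≤ n) (ε : ℝ) (hε : 0 < ε)
    (hδ : Real.sqrt (45 * ε / n) ≤ 0.7)
    (v v' : Fin n → ℝ) (hv : ∀ i, v i = 1 ∨ v i = -1) (hv' : ∀ i, v' i = 1 ∨ v' i = -1)
    (k : ℝ) (hk : 0 < k)
    (r : Fin n → EuclideanSpace ℝ (Fin 3)) (hr : ∀ i, ‖r i‖ ≤ 1)
    (h : (n : ℝ) - k * ε ≤ ∑ i : Fin n, ⟪r i, nhat (Real.sqrt (45 * ε / n) * v' i)⟫) :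
    (n : ℝ) - (k + 30 * Real.sqrt (2 * k) + 90) * ε ≤
      ∑ i : Fin n, ⟪r i, nhat (Real.sqrt (45 * ε / n) * v i)⟫ := by
  set δ := Real.sqrt (45 * ε / n) with hδ_def
  have hn0 : (0 : ℝ) < n := by exact_mod_cast hn
  have hδ0 : 0 ≤ δ := Real.sqrt_nonneg _
  have hδn : n * δ ^ 2 = 45 * ε := by
    rw [hδ_def, Real.sq_sqrt (by positivity)]
    field_simp
  have hterm : ∀ i, ⟪r i, nhat (δ * v' i)⟫ - 2 * δ * ‖r i - nhat (δ * v' i)‖ - (2 * δ) ^ 2 / 2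
      ≤ ⟪r i, nhat (δ * v i)⟫ := by
    intro i
    refine inner_sub_le_inner_of_norm_sub_le (norm_nhat _) (norm_nhat _)
      ((norm_nhat_sub_le _ _).trans ?_)
    rw [abs_le]
    rcases hv i with h1 | h1 <;> rcases hv' i with h2 | h2 <;> rw [h1, h2] <;>
      constructor <;> linarith
  have hsum := Finset.sum_le_sum fun i (_ : i ∈ Finset.univ) => hterm i
  rw [Finset.sum_sub_distrib, Finset.sum_sub_distrib, ← Finset.mul_sum, Finset.sum_const,
    Finset.card_univ, Fintype.card_fin, nsmul_eq_mul] at hsum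
  set S := ∑ i, ‖r i - nhat (δ * v' i)‖ with hS
  have hsq : ∑ i, ‖r i - nhat (δ * v' i)‖ ^ 2 ≤ 2 * (k * ε) := by
    have hle : ∑ i, ‖r i - nhat (δ * v' i)‖ ^ 2 ≤ ∑ i, (2 - 2 * ⟪r i, nhat (δ * v' i)⟫) := by
      refine Finset.sum_le_sum fun i _ => ?_
      rw [norm_sub_sq_real, norm_nhat]
      nlinarith [hr i, norm_nonneg (r i)]
    rw [Finset.sum_sub_distrib, ← Finset.mul_sum, Finset.sum_const, Finset.card_univ,
      Fintype.card_fin, nsmul_eq_mul] at hle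
    linarith
  have hS2 : S ^ 2 ≤ n * (2 * (k * ε)) := by
    have hcs := sq_sum_le_card_mul_sum_sq (s := Finset.univ)
      (f := fun i => ‖r i - nhat (δ * v' i)‖)
    rw [Finset.card_univ, Fintype.card_fin] at hcs
    exact hcs.trans (by gcongr)
  have hδS : 2 * δ * S ≤ 30 * Real.sqrt (2 * k) * ε := by
    apply abs_le_of_sq_le_sq' _ (by positivity) |>.2
    have hk2 : Real.sqrt (2 * k) ^ 2 = 2 * k := Real.sq_sqrt (by positivity)
    calc (2 * δ * S) ^ 2 = 4 * δ ^ 2 * S ^ 2 := by ring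
      _ ≤ 4 * δ ^ 2 * (n * (2 * (k * ε))) := by gcongr
      _ = 8 * (n * δ ^ 2) * (k * ε) := by ring
      _ = 360 * (k * ε ^ 2) := by rw [hδn]; ring
      _ ≤ 1800 * (k * ε ^ 2) := by gcongr; norm_num
      _ = 900 * (2 * k) * ε ^ 2 := by ring
      _ = (30 * Real.sqrt (2 * k) * ε) ^ 2 := by rw [mul_pow, mul_pow, hk2]; norm_num
  linarith
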